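/- Let K be a field of characteristic zero, R = K[x,y,z], and let a, b, c, α, β, γ be integers with 1 ≤ α ≤ a−1, 1 ≤ β ≤ b−1, 1 ≤ γ ≤ c−1 and α + γ = b. Let I = (x^a, y^b − x^α z^γ, z^c, x^{a−α} y^{b−β}, y^{b−β} z^{c−γ}) ⊆ R. If at least one of the integers a, b, c is equal to 3, then R/I has the weak Lefschetz property. -/

import Mathlib

open MvPolynomial

/-- The degree-`i` graded component of `R/I`, i.e. the image in `R/I` of the
space of homogeneous polynomials of degree `i`. -/
noncomputable def grComponent (K : Type*) [Field K]
    (I : Ideal (MvPolynomial (Fin 3) K)) (i : ℕ) :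
    Submodule K (MvPolynomial (Fin 3) K ⧸ I) :=
  (MvPolynomial.homogeneousSubmodule (Fin 3) K i).map
    (Ideal.Quotient.mkₐ K I).toLinearMap

/-- The Hilbert function of `R/I`. -/
noncomputable def hilb (K : Type*) [Field K]
    (I : Ideal (MvPolynomial (Fin 3) K)) (i : ℕ) : ℕ :=
  Module.finrank K (grComponent K I i)

/-- `R/I` has the weak Lefschetz property: there is a linear form `L` such that
for every `i`, multiplication by `L` from `[R/I]_i` to `[R/I]_{i+1}` is
injective or surjective. -/
def hasWLP (K : Type*) [Field K] (I : Ideal (MvPolynomial (Fin 3) K)) : Prop :=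
  ∃ L : MvPolynomial (Fin 3) K, L.IsHomogeneous 1 ∧
    ∀ i : ℕ,
      (∀ u ∈ grComponent K I i, ∀ v ∈ grComponent K I i,
          Ideal.Quotient.mk I L * u = Ideal.Quotient.mk I L * v → u = v) ∨
      (∀ w ∈ grComponent K I (i + 1), ∃ u ∈ grComponent K I i,
          Ideal.Quotient.mk I L * u = w)

section QuotientRing

variable {Q : Type*} [CommRing Q]

theorem sq_mul_add_pow {x z : Q} (hx : x ^ 3 = 0) (n : ℕ) :
    x ^ 2 * (x + z) ^ n = x ^ 2 * z ^ n := by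
  induction n with
  | zero => simp
  | succ n ih => linear_combination (x + z) * ih + z ^ n * hx

theorem mul_add_pow_succ {x z : Q} (hx : x ^ 3 = 0) (n : ℕ) :
    x * (x + z) ^ (n + 1) = x * z ^ (n + 1) + (n + 1) * (x ^ 2 * z ^ n) := by
  induction n with
  | zero => simp; ring
  | succ n ih =>
    push_cast
    linear_combination (x + z) * ih + (n + 1) * z ^ n * hx

theorem two_mul_add_pow {x z : Q} (hx : x ^ 3 = 0) (n : ℕ) :
    2 * (x + z) ^ (n + 2) = 2 * z ^ (n + 2) + 2 * (n + 2) * (x * z ^ (n + 1))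
      + (n + 2) * (n + 1) * (x ^ 2 * z ^ n) := by
  induction n with
  | zero => simp; ring
  | succ n ih =>
    push_cast
    linear_combination (x + z) * ih + (n + 2) * (n + 1) * z ^ n * hx

theorem two_mul_add_pow_mul {x z : Q} (hx : x ^ 3 = 0) {r s n : ℕ} (h : r + s = n + 2) :
    2 * ((x + z) ^ r * z ^ s) = 2 * z ^ (n + 2) + 2 * r * (x * z ^ (n + 1))
      + r * (r - 1) * (x ^ 2 * z ^ n) := by
  match r with
  | 0 => obtain rfl : s = n + 2 := by omega
         simp
  | 1 => obtain rfl : s = n + 1 := by omega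
         simp; ring
  | r + 2 =>
    obtain rfl : n = r + s := by omega
    push_cast
    linear_combination z ^ s * two_mul_add_pow (z := z) hx r

/-- The consequences in degree `n + 2` of a relation of degree `k + 2` with leading term
`2 z ^ (k + 2)`. -/
theorem relation_in_degree {x z p q : Q} (hx : x ^ 3 = 0) {k : ℕ}
    (h : 2 * z ^ (k + 2) + p * (x * z ^ (k + 1)) + q * (x ^ 2 * z ^ k) = 0) (n : ℕ) :
    (∀ m, n = k + m → 2 * z ^ (n + 2) + p * (x * z ^ (n + 1)) + q * (x ^ 2 * z ^ n) = 0) ∧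
    (∀ m, n = k + 1 + m → 2 * (x * z ^ (n + 1)) + p * (x ^ 2 * z ^ n) = 0) ∧
    (∀ m, n = k + 2 + m → 2 * (x ^ 2 * z ^ n) = 0) := by
  refine ⟨?_, ?_, ?_⟩ <;> rintro m rfl
  · linear_combination z ^ m * h
  · linear_combination x * z ^ m * h - q * z ^ (k + m) * hx
  · linear_combination
      x ^ 2 * z ^ m * h - (p * z ^ (k + 1 + m) + q * x * z ^ (k + m)) * hx

theorem monomial_eq_zero_of_add {x y z : Q} (hx : x ^ 3 = 0) (hy : y = x + z) {n : ℕ}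
    (h0 : z ^ (n + 2) = 0) (h1 : x * z ^ (n + 1) = 0) (h2 : x ^ 2 * z ^ n = 0)
    (i j k : ℕ) (h : i + j + k = n + 2) : x ^ i * y ^ j * z ^ k = 0 := by
  induction j generalizing i k with
  | zero =>
    match i with
    | 0 => obtain rfl : k = n + 2 := by omega
           simpa using h0
    | 1 => obtain rfl : k = n + 1 := by omega
           simpa using h1
    | 2 => obtain rfl : k = n := by omega
           simpa using h2
    | i + 3 => rw [pow_add, hx]; simp
  | succ j ih =>
    have e1 := ih (i + 1) k (by omega)
    have e2 := ih i (k + 1) (by omega)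
    linear_combination e1 + e2 + x ^ i * y ^ j * z ^ k * hy

theorem monomial_eq_zero_of_cube (hQ : ∀ (m : ℤ) (q : Q), m ≠ 0 → m * q = 0 → q = 0)
    {x y z : Q} {b c α β γ : ℕ}
    (hα1 : 1 ≤ α) (hα2 : α ≤ 2) (hβ1 : 1 ≤ β) (hβ2 : β ≤ b - 1)
    (hγ1 : 1 ≤ γ) (hγ2 : γ ≤ c - 1) (hαγ : α + γ = b)
    (hx : x ^ 3 = 0) (hy : y = x + z) (hb : y ^ b = x ^ α * z ^ γ) (hz : z ^ c = 0)
    (hxy : x ^ (3 - α) * y ^ (b - β) = 0) (hyz : y ^ (b - β) * z ^ (c - γ) = 0)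
    (i j k : ℕ) (h : i + j + k = (b + c - β) / 2 + 1) : x ^ i * y ^ j * z ^ k = 0 := by
  obtain ⟨n, hn⟩ : ∃ n, (b + c - β) / 2 + 1 = n + 2 := ⟨(b + c - β) / 2 - 1, by omega⟩
  have H2 (q : Q) (hq : 2 * q = 0) : q = 0 := hQ 2 q (by norm_num) (by exact_mod_cast hq)
  suffices z ^ (n + 2) = 0 ∧ x * z ^ (n + 1) = 0 ∧ x ^ 2 * z ^ n = 0 from
    monomial_eq_zero_of_add hx hy this.1 this.2.1 this.2.2 i j k (by omega)
  generalize hE0 : z ^ (n + 2) = E0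
  generalize hE1 : x * z ^ (n + 1) = E1
  generalize hE2 : x ^ 2 * z ^ n = E2
  have relz := relation_in_degree (p := 0) (q := 0) hx (z := z) (k := c - 2)
    (by rw [show c - 2 + 2 = c by omega, hz]; simp) n
  have relyz := relation_in_degree hx (k := c + α - β - 2)
    ((two_mul_add_pow_mul hx (z := z) (r := b - β) (s := c - γ) (by omega)).symm.trans
      (by rw [← hy, hyz, mul_zero])) n
  rw [hE0, hE1, hE2] at relz relyz
  rw [Nat.cast_sub (by omega)] at relyz
  simp only [zero_mul, add_zero] at relz
  have fin (p q : Q) (h0 : 2 * E0 + p * E1 + q * E2 = 0) (h1 : 2 * E1 + p * E2 = 0)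
      (h2 : E2 = 0) : E0 = 0 ∧ E1 = 0 ∧ E2 = 0 := by
    have h1' : E1 = 0 := H2 _ (by linear_combination h1 - p * h2)
    exact ⟨H2 _ (by linear_combination h0 - p * h1' - q * h2), h1', h2⟩
  have hβb : β < b := by omega
  subst hy
  obtain rfl | rfl : α = 1 ∨ α = 2 := by omega
  · have relb := relation_in_degree hx (z := z) (p := 2 * (b - 1)) (q := b * (b - 1)) (k := b - 2)
      (by
        have e := two_mul_add_pow_mul hx (z := z) (r := b) (s := 0) (n := b - 2) (by omega)
        rw [pow_zero, mul_one, hb, show γ = b - 2 + 1 by omega] at e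
        linear_combination -e) n
    rw [hE0, hE1, hE2] at relb
    have relxy (m : ℕ) (hm : n = b - β + m) : E2 = 0 := by
      rw [sq_mul_add_pow hx] at hxy
      rw [← hE2, hm, pow_add, ← mul_assoc, hxy, zero_mul]
    by_cases h3 : b - β ≤ n
    · by_cases h2 : b ≤ n + 1
      · exact fin _ _ (relb.1 (n + 2 - b) (by omega)) (relb.2.1 (n + 1 - b) (by omega))
          (relxy (n + β - b) (by omega))
      by_cases h4 : c ≤ n + β
      · exact fin _ _ (relyz.1 (n + 1 + β - c) (by omega)) (relyz.2.1 (n + β - c) (by omega))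
          (relxy (n + β - b) (by omega))
      have r1 := relb.1 (n + 2 - b) (by omega)
      have r2 := relyz.1 (n + 1 + β - c) (by omega)
      have e2 := relxy (n + β - b) (by omega)
      refine fin _ _ r1 ?_ e2
      have : E1 = 0 := by
        refine hQ (2 * (β - 1)) _ (by omega) ?_
        push_cast
        linear_combination r1 - r2 + (-b * (b - 1) + (b - β) * (b - β - 1)) * e2
      rw [this, e2]; simp
    · by_cases h1 : c ≤ n
      · exact fin _ _ (relyz.1 (n + 1 + β - c) (by omega)) (relyz.2.1 (n + β - c) (by omega))
          (H2 _ (relz.2.2 (n - c) (by omega)))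
      have e0 := H2 _ (relz.1 (n + 2 - c) (by omega))
      obtain rfl : β = 1 := by omega
      have r1 := relb.1 (n + 2 - b) (by omega)
      have r2 := relyz.1 (n + 2 - c) (by omega)
      push_cast at r2
      have e2 : E2 = 0 := by
        refine hQ (2 * (b - 1)) _ (by omega) ?_
        push_cast
        linear_combination r1 - r2
      have e1 : E1 = 0 := by
        refine hQ (2 * (b - 1)) _ (by omega) ?_
        push_cast
        linear_combination r1 - 2 * e0 - b * (b - 1) * e2
      exact ⟨e0, e1, e2⟩
  · have relb := relation_in_degree hx (z := z) (p := 2 * b) (q := b * (b - 1) - 2) (k := b - 2)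
      (by
        have e := two_mul_add_pow_mul hx (z := z) (r := b) (s := 0) (n := b - 2) (by omega)
        rw [pow_zero, mul_one, hb, show γ = b - 2 by omega] at e
        linear_combination -e) n
    rw [hE0, hE1, hE2] at relb
    obtain ⟨r, hr⟩ : ∃ r, b - β = r + 1 := ⟨b - β - 1, by omega⟩
    have hbr : (b - β : Q) = r + 1 := by rw [← Nat.cast_sub hβb.le, hr]; simp
    rw [show 3 - 2 = 1 from rfl, pow_one, hr, mul_add_pow_succ hx] at hxy
    have relxy1 (m : ℕ) (hm : n = r + m) : E1 + (b - β) * E2 = 0 := by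
      rw [hbr, ← hE1, ← hE2, hm]
      linear_combination z ^ m * hxy
    have relxy2 (m : ℕ) (hm : n = r + 1 + m) : E2 = 0 := by
      rw [← hE2, hm]
      linear_combination x * z ^ m * hxy - (r + 1) * z ^ (r + m) * hx
    by_cases h3 : b - β ≤ n
    · have e2 := relxy2 (n - r - 1) (by omega)
      have e1 : E1 = 0 := by linear_combination relxy1 (n - r) (by omega) - (b - β) * e2
      by_cases h2 : b ≤ n + 2
      · exact ⟨H2 _ (by linear_combination relb.1 (n + 2 - b) (by omega) - 2 * b * e1
          - (b * (b - 1) - 2) * e2), e1, e2⟩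
      · exact ⟨H2 _ (by linear_combination relyz.1 (n + β - c) (by omega) - 2 * (b - β) * e1
          - ((b - β) * (b - β - 1)) * e2), e1, e2⟩
    by_cases h1 : c ≤ n + 1
    · have e0 := H2 _ (relz.1 (n + 2 - c) (by omega))
      have e1 := H2 _ (relz.2.1 (n + 1 - c) (by omega))
      refine ⟨e0, e1, ?_⟩
      by_cases h1' : c ≤ n
      · exact H2 _ (relz.2.2 (n - c) (by omega))
      have r3 := relxy1 (n - r) (by omega)
      refine hQ (b - β) _ (by omega) ?_
      push_cast
      linear_combination r3 - e1
    have e0 := H2 _ (relz.1 (n + 2 - c) (by omega))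
    have r3 := relxy1 (n - r) (by omega)
    have e2 : E2 = 0 := by
      obtain rfl | rfl : β = 1 ∨ β = 2 := by omega
      · have r2 := relb.1 (n + 2 - b) (by omega)
        refine hQ (b * (b - 1) + 2) _ (by nlinarith) ?_
        push_cast at r3 ⊢
        linear_combination 2 * b * r3 - r2 + 2 * e0
      · have r2 := relyz.1 (n + 2 - c) (by omega)
        refine hQ ((b - 2) * (b - 1)) _ (mul_ne_zero (by omega) (by omega)) ?_
        push_cast at r2 r3 ⊢
        linear_combination 2 * (b - 2) * r3 - r2 + 2 * e0
    exact ⟨e0, by linear_combination r3 - (b - β) * e2, e2⟩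

/-- Lagrange interpolation at the points `y / z = 1, 2, -3` of the binary cubic
`(y - z) (y - 2 z) (y + 3 z)`, where `x / z` takes the values `1, 8, -27`. -/
theorem twenty_mul_monomial_eq {x y z : Q} (hx : x = 7 * y - 6 * z) (hy : y ^ 3 = x * z ^ 2)
    (n i j k : ℕ) (h : i + j + k = n + 2) :
    20 * (x ^ i * y ^ j * z ^ k) =
      -5 * (z ^ n * ((y - 2 * z) * (y + 3 * z)))
      + 8 ^ i * 2 ^ j * (4 * (z ^ n * ((y - z) * (y + 3 * z))))
      + (-27) ^ i * (-3) ^ j * (z ^ n * ((y - z) * (y - 2 * z))) := by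
  subst hx
  induction n generalizing i j k with
  | zero =>
    obtain ⟨rfl, rfl, rfl⟩ | ⟨rfl, rfl, rfl⟩ | ⟨rfl, rfl, rfl⟩ | ⟨rfl, rfl, rfl⟩ |
      ⟨rfl, rfl, rfl⟩ | ⟨rfl, rfl, rfl⟩ : (i = 0 ∧ j = 0 ∧ k = 2) ∨ (i = 0 ∧ j = 1 ∧ k = 1) ∨
      (i = 0 ∧ j = 2 ∧ k = 0) ∨ (i = 1 ∧ j = 0 ∧ k = 1) ∨ (i = 1 ∧ j = 1 ∧ k = 0) ∨
      (i = 2 ∧ j = 0 ∧ k = 0) := by omega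
    all_goals ring
  | succ n ih =>
    by_cases hi : i = 0
    · by_cases hj : j = 0
      · obtain ⟨k, rfl⟩ : ∃ l, k = l + 1 := ⟨k - 1, by omega⟩
        linear_combination z * ih i j k (by omega)
      · obtain ⟨j, rfl⟩ : ∃ l, j = l + 1 := ⟨j - 1, by omega⟩
        linear_combination y * ih i j k (by omega) +
          z ^ n * (-5 + 8 ^ i * 2 ^ j * 4 + (-27) ^ i * (-3) ^ j) * hy
    · obtain ⟨i, rfl⟩ : ∃ l, i = l + 1 := ⟨i - 1, by omega⟩
      linear_combination (7 * y - 6 * z) * ih i j k (by omega) +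
          7 * z ^ n * (-5 + 8 ^ i * 2 ^ j * 4 + (-27) ^ i * (-3) ^ j) * hy

theorem monomial_eq_zero_of_binomial_cubic
    (hQ : ∀ (m : ℤ) (q : Q), m ≠ 0 → m * q = 0 → q = 0)
    {x y z : Q} {a c β : ℕ} (ha : 2 ≤ a) (hc : 3 ≤ c) (hβ1 : 1 ≤ β) (hβ2 : β ≤ 2)
    (hx : x = 7 * y - 6 * z) (hy : y ^ 3 = x * z ^ 2) (hxa : x ^ a = 0) (hz : z ^ c = 0)
    (hxy : x ^ (a - 1) * y ^ (3 - β) = 0) (hyz : y ^ (3 - β) * z ^ (c - 2) = 0)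
    (i j k : ℕ) (h : i + j + k = (a + c - β) / 2 + 1) : x ^ i * y ^ j * z ^ k = 0 := by
  obtain ⟨n, hn⟩ : ∃ n, (a + c - β) / 2 + 1 = n + 2 := ⟨(a + c - β) / 2 - 1, by omega⟩
  have H (q : Q) (m : ℤ) (hm : m ≠ 0) (hq : m * q = 0) : q = 0 := hQ m q hm hq
  have hxp (r s t : ℕ) (hr : a ≤ r) : x ^ r * y ^ s * z ^ t = 0 := by
    rw [pow_eq_zero_of_le hr hxa]; simp
  have hzp (r s t : ℕ) (hr : c ≤ t) : x ^ r * y ^ s * z ^ t = 0 := by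
    rw [pow_eq_zero_of_le hr hz]; simp
  have hxyp (r s t : ℕ) (hr : a - 1 ≤ r) (hs : 3 - β ≤ s) : x ^ r * y ^ s * z ^ t = 0 := by
    obtain ⟨r, rfl⟩ := Nat.exists_eq_add_of_le hr
    obtain ⟨s, rfl⟩ := Nat.exists_eq_add_of_le hs
    linear_combination x ^ r * y ^ s * z ^ t * hxy
  have hyzp (r s t : ℕ) (hs : 3 - β ≤ s) (ht : c - 2 ≤ t) : x ^ r * y ^ s * z ^ t = 0 := by
    obtain ⟨t, rfl⟩ := Nat.exists_eq_add_of_le ht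
    obtain ⟨s, rfl⟩ := Nat.exists_eq_add_of_le hs
    linear_combination x ^ r * y ^ s * z ^ t * hyz
  have key := twenty_mul_monomial_eq hx hy n
  have F (r s t : ℕ) (hd : r + s + t = n + 2) (h0 : x ^ r * y ^ s * z ^ t = 0) :=
    (key r s t hd).symm.trans (by rw [h0, mul_zero])
  generalize -5 * (z ^ n * ((y - 2 * z) * (y + 3 * z))) = f at key F
  generalize 4 * (z ^ n * ((y - z) * (y + 3 * z))) = g at key F
  generalize z ^ n * ((y - z) * (y - 2 * z)) = e at key F
  suffices g = 0 ∧ e = 0 ∧ f + g + e = 0 by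
    obtain ⟨hg, he, hf⟩ := this
    refine H _ 20 (by norm_num) ?_
    push_cast
    rw [key i j k (by omega)]
    linear_combination hf + (8 ^ i * 2 ^ j - 1) * hg + ((-27) ^ i * (-3) ^ j - 1) * he
  by_cases hc' : c ≤ n + β
  · have r0 := F 0 0 (n + 2) (by omega) (hzp _ _ _ (by omega))
    have r1 := F 0 1 (n + 1) (by omega) (by
      obtain rfl | rfl : β = 1 ∨ β = 2 := by omega
      exacts [hzp _ _ _ (by omega), hyzp _ _ _ (by omega) (by omega)])
    have r2 := F 0 2 n (by omega) (hyzp _ _ _ (by omega) (by omega))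
    have he : e = 0 := by
      refine H _ 20 (by norm_num) ?_
      push_cast
      linear_combination r2 - 3 * r1 + 2 * r0
    exact ⟨by linear_combination r1 - r0 + 4 * he, he, by linear_combination r0⟩
  by_cases ha' : a ≤ n + 1
  · have r0 := F (n + 2) 0 0 (by omega) (hxp _ _ _ (by omega))
    have r1 := F (n + 1) 0 1 (by omega) (hxp _ _ _ (by omega))
    have r2 := F n 2 0 (by omega) (hxyp _ _ _ (by omega) (by omega))
    have he : e = 0 := by
      refine H _ (1260 * (-27) ^ n) (by simp) ?_
      push_cast
      linear_combination r0 - 15 * r1 + 14 * r2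
    have hg : g = 0 := by
      refine H _ (4 * 8 ^ n) (by simp) ?_
      push_cast
      linear_combination r1 - r2 + 36 * (-27) ^ n * he
    exact ⟨hg, he, by linear_combination r2 + (1 - 4 * 8 ^ n) * hg + (1 - 9 * (-27) ^ n) * he⟩
  have r0 := F (n + 2) 0 0 (by omega) (hxp _ _ _ (by omega))
  obtain rfl | rfl : β = 1 ∨ β = 2 := by omega
  · have r1 := F 0 0 (n + 2) (by omega) (hzp _ _ _ (by omega))
    have r2 := F 0 2 n (by omega) (hyzp _ _ _ (by omega) (by omega))
    have he : e = 0 := by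
      refine H _ (3 * (-27) ^ (n + 2) - 8 * 8 ^ (n + 2) + 5) ?_ ?_
      · have h8 : ∀ m : ℕ, (8 : ℤ) ^ m % 9 = 1 ∨ (8 : ℤ) ^ m % 9 = 8 := fun m ↦ by
          induction m with
          | zero => simp
          | succ m ih => rw [pow_succ]; omega
        have := h8 (n + 2)
        have : (-27 : ℤ) ^ (n + 2) = (-27) ^ n * 729 := by ring
        omega
      · push_cast
        linear_combination 3 * r0 - 3 * r1 - (8 ^ (n + 2) - 1) * (r2 - r1)
    have hg : g = 0 := by
      refine H _ 3 (by norm_num) ?_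
      push_cast
      linear_combination r2 - r1 - 8 * he
    exact ⟨hg, he, by linear_combination r1⟩
  · have r1 := F (n + 1) 1 0 (by omega) (hxyp _ _ _ (by omega) (by omega))
    have r2 := F 0 1 (n + 1) (by omega) (hyzp _ _ _ (by omega) (by omega))
    have he : e = 0 := by
      refine H _ (6 * (3 * 8 ^ (n + 1) + 5 * 8 ^ (n + 1) * (-27) ^ (n + 1)
        - 8 * (-27) ^ (n + 1))) ?_ ?_
      · intro h0
        have h3 : (3 : ℤ) ∣ 8 ^ (n + 1) :=
          ⟨3 * (5 * 8 ^ (n + 1) * (-27) ^ n - 8 * (-27) ^ n), by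
            have : (18 : ℤ) ≠ 0 := by norm_num
            refine mul_left_cancel₀ this ?_
            linear_combination h0⟩
        have := Int.prime_three.dvd_of_dvd_pow h3
        norm_num at this
      · push_cast
        linear_combination 6 * 8 ^ (n + 1) * (r1 - r2) - (2 * 8 ^ (n + 1) - 2) * (r0 - r1)
    have hg : g = 0 := by
      refine H _ (6 * 8 ^ (n + 1)) (by simp) ?_
      push_cast
      linear_combination r0 - r1 + 24 * (-27) ^ (n + 1) * he
    exact ⟨hg, he, by linear_combination r2 - hg + 4 * he⟩

end QuotientRing

section Core

variable {K : Type*} [Field K]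

theorem monomial_fin_three (s : Fin 3 →₀ ℕ) (r : K) :
    monomial s r = C r * (X 0 ^ s 0 * X 1 ^ s 1 * X 2 ^ s 2) := by
  rw [monomial_eq, Finsupp.prod_fintype _ _ (by simp), Fin.prod_univ_three]

theorem mem_of_forall_monomial_mem {J : Ideal (MvPolynomial (Fin 3) K)} {d : ℕ}
    (hJ : ∀ i j k : ℕ, i + j + k = d → (X 0 ^ i * X 1 ^ j * X 2 ^ k : MvPolynomial _ K) ∈ J)
    {D : ℕ} (hD : d ≤ D) {p : MvPolynomial (Fin 3) K} (hp : p.IsHomogeneous D) : p ∈ J := by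
  have key : ∀ i j k : ℕ, i + j + k = D →
      (X 0 ^ i * X 1 ^ j * X 2 ^ k : MvPolynomial _ K) ∈ J := by
    clear hp p
    induction D, hD using Nat.le_induction with
    | base => exact hJ
    | succ D hD ih =>
      intro i j k h
      by_cases hi : i = 0
      · by_cases hj : j = 0
        · obtain ⟨k, rfl⟩ : ∃ l, k = l + 1 := ⟨k - 1, by omega⟩
          convert J.mul_mem_left (X 2) (ih i j k (by omega)) using 1
          ring
        · obtain ⟨j, rfl⟩ : ∃ l, j = l + 1 := ⟨j - 1, by omega⟩
          convert J.mul_mem_left (X 1) (ih i j k (by omega)) using 1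
          ring
      · obtain ⟨i, rfl⟩ : ∃ l, i = l + 1 := ⟨i - 1, by omega⟩
        convert J.mul_mem_left (X 0) (ih i j k (by omega)) using 1
        ring
  rw [p.as_sum]
  refine J.sum_mem fun s hs ↦ ?_
  rw [monomial_fin_three]
  refine J.mul_mem_left _ (key _ _ _ ?_)
  have := hp (mem_support_iff.1 hs)
  rw [← this, Finsupp.weight_apply, Finsupp.sum_fintype _ _ (by simp), Fin.sum_univ_three]
  simp

attribute [local instance] MvPolynomial.gradedAlgebra in
/-- The weak Lefschetz property for a graded quotient with Gorenstein duality in socle degree `e`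
follows from the vanishing of `R / (I, L)` in degree `e / 2 + 1`. -/
theorem hasWLP_of_duality {I : Ideal (MvPolynomial (Fin 3) K)} {e : ℕ}
    (hI : I.IsHomogeneous (homogeneousSubmodule (Fin 3) K))
    (hdual : ∀ i ≤ e, ∀ p : MvPolynomial (Fin 3) K, p.IsHomogeneous i →
      (∀ w : MvPolynomial (Fin 3) K, w.IsHomogeneous (e - i) → p * w ∈ I) → p ∈ I)
    {L : MvPolynomial (Fin 3) K} (hL : L.IsHomogeneous 1)
    (hJ : ∀ i j k : ℕ, i + j + k = e / 2 + 1 →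
      (X 0 ^ i * X 1 ^ j * X 2 ^ k : MvPolynomial _ K) ∈ I ⊔ Ideal.span {L}) :
    hasWLP K I := by
  have hJ' {D : ℕ} (hD : e / 2 + 1 ≤ D) {p : MvPolynomial (Fin 3) K} (hp : p.IsHomogeneous D) :
      ∃ s ∈ I, ∃ q, p = s + L * q := by
    obtain ⟨s, hs, t, ht, rfl⟩ := Submodule.mem_sup.1 (mem_of_forall_monomial_mem hJ hD hp)
    obtain ⟨q, rfl⟩ := Ideal.mem_span_singleton'.1 ht
    exact ⟨s, hs, q, by rw [mul_comm]⟩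
  refine ⟨L, hL, fun i ↦ ?_⟩
  by_cases hi : i + 1 ≤ e / 2
  · left
    intro u hu v hv huv
    obtain ⟨p, hp, hpuv⟩ := sub_mem hu hv
    have hp : p.IsHomogeneous i := hp
    have hpuv : Ideal.Quotient.mk I p = u - v := hpuv
    rw [← sub_eq_zero, ← hpuv, Ideal.Quotient.eq_zero_iff_mem]
    have hLp : L * p ∈ I := by
      rw [← Ideal.Quotient.eq_zero_iff_mem, map_mul, hpuv, mul_sub, huv, sub_self]
    refine hdual i (by omega) p hp fun w hw ↦ ?_
    obtain ⟨s, hs, q, rfl⟩ := hJ' (by omega) hw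
    rw [mul_add]
    refine I.add_mem (I.mul_mem_left _ hs) ?_
    convert I.mul_mem_left q hLp using 1
    ring
  · right
    rintro w ⟨p, hp, rfl⟩
    have hp : p.IsHomogeneous (i + 1) := hp
    obtain ⟨s, hs, q, rfl⟩ := hJ' (by omega) hp
    refine ⟨Ideal.Quotient.mk I (DirectSum.decompose (homogeneousSubmodule (Fin 3) K) q i),
      ⟨_, (DirectSum.decompose (homogeneousSubmodule (Fin 3) K) q i).2, rfl⟩, ?_⟩
    change _ = Ideal.Quotient.mk I _
    rw [← map_mul, eq_comm, Ideal.Quotient.mk_eq_mk_iff_sub_mem]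
    have h := hI (i + 1) hs
    convert h using 1
    have h1 := DirectSum.decompose_of_mem_same (homogeneousSubmodule (Fin 3) K) hp
    rw [DirectSum.decompose_add, DirectSum.add_apply, Submodule.coe_add, add_comm i 1,
      DirectSum.coe_decompose_mul_add_of_left_mem _ hL] at h1
    rw [add_comm i 1]
    linear_combination -h1


/-- The exponents of the monomials in the Macaulay dual generator
`∑ k, X ^ (a - 1 - k α) Y ^ ((k + 1) b - β - 1) Z ^ (c - 1 - k γ)`. -/
def IsDualExponent (a b c α β γ : ℕ) (s : Fin 3 →₀ ℕ) : Prop :=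
  ∃ k : ℕ, s 0 + k * α + 1 = a ∧ s 1 + β + 1 = (k + 1) * b ∧ s 2 + k * γ + 1 = c

open Classical in
/-- The linear functional dual to the Macaulay dual generator. -/
noncomputable def dualFunctional (K : Type*) [Field K] (a b c α β γ : ℕ) :
    MvPolynomial (Fin 3) K →ₗ[K] K :=
  (basisMonomials (Fin 3) K).constr K fun s ↦ if IsDualExponent a b c α β γ s then 1 else 0

open Classical in
theorem dualFunctional_monomial (a b c α β γ : ℕ) (s : Fin 3 →₀ ℕ) (r : K) :
    dualFunctional K a b c α β γ (monomial s r) =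
      if IsDualExponent a b c α β γ s then r else 0 := by
  have h := (basisMonomials (Fin 3) K).constr_basis K
    (fun s ↦ if IsDualExponent a b c α β γ s then (1 : K) else 0) s
  rw [coe_basisMonomials] at h
  rw [← mul_one r, ← smul_eq_mul, ← smul_monomial, map_smul, dualFunctional, h]
  simp

/-- The ideal of the statement. -/
noncomputable abbrev binomialIdeal (K : Type*) [Field K] (a b c α β γ : ℕ) :
    Ideal (MvPolynomial (Fin 3) K) :=
  Ideal.span {(X 0 : MvPolynomial (Fin 3) K) ^ a,
      X 1 ^ b - X 0 ^ α * X 2 ^ γ, X 2 ^ c,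
      X 0 ^ (a - α) * X 1 ^ (b - β), X 1 ^ (b - β) * X 2 ^ (c - γ)}

/-- The exponent of `x ^ i y ^ j z ^ k`. -/
noncomputable def expo (i j k : ℕ) : Fin 3 →₀ ℕ := Finsupp.equivFunOnFinite.symm ![i, j, k]

@[simp] theorem expo_zero (i j k : ℕ) : expo i j k 0 = i := rfl
@[simp] theorem expo_one (i j k : ℕ) : expo i j k 1 = j := rfl
@[simp] theorem expo_two (i j k : ℕ) : expo i j k 2 = k := rfl

theorem monomial_expo (i j k : ℕ) (r : K) :
    monomial (expo i j k) r = C r * (X 0 ^ i * X 1 ^ j * X 2 ^ k) := by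
  simp [monomial_fin_three]

theorem finsupp_fin_three_ext {s t : Fin 3 →₀ ℕ} (h0 : s 0 = t 0) (h1 : s 1 = t 1)
    (h2 : s 2 = t 2) : s = t := by
  ext i
  fin_cases i <;> assumption

section Parameters

universe u

variable {a b c α β γ : ℕ}

theorem dualFunctional_eq_zero (hα1 : 1 ≤ α) (hα2 : α ≤ a - 1) (hβ2 : β ≤ b - 1)
    (hγ1 : 1 ≤ γ) (hγ2 : γ ≤ c - 1) {p : MvPolynomial (Fin 3) K}
    (hp : p ∈ binomialIdeal K a b c α β γ) : dualFunctional K a b c α β γ p = 0 := by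
  classical
  have mono (i j k : ℕ) (s : Fin 3 →₀ ℕ) (r : K)
      (h : ¬ IsDualExponent a b c α β γ (s + expo i j k)) :
      dualFunctional K a b c α β γ (monomial s r * (X 0 ^ i * X 1 ^ j * X 2 ^ k)) = 0 := by
    have := monomial_expo i j k (1 : K)
    rw [C_1, one_mul] at this
    rw [← this, monomial_mul, dualFunctional_monomial, if_neg h]
  have gen : ∀ g ∈ ({(X 0 : MvPolynomial (Fin 3) K) ^ a,
      X 1 ^ b - X 0 ^ α * X 2 ^ γ, X 2 ^ c,
      X 0 ^ (a - α) * X 1 ^ (b - β), X 1 ^ (b - β) * X 2 ^ (c - γ)} : Set _),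
      ∀ s r, dualFunctional K a b c α β γ (monomial s r * g) = 0 := by
    rintro g (rfl | rfl | rfl | rfl | rfl) s r
    · convert mono a 0 0 s r ?_ using 2
      · ring
      · rintro ⟨k, h, -, -⟩
        simp at h
        omega
    · have e1 : (X 1 ^ b : MvPolynomial (Fin 3) K) = monomial (expo 0 b 0) 1 := by
        simp [monomial_expo]
      have e2 : (X 0 ^ α * X 2 ^ γ : MvPolynomial (Fin 3) K) = monomial (expo α 0 γ) 1 := by
        simp [monomial_expo]
      rw [mul_sub, e1, e2, monomial_mul, monomial_mul, map_sub, dualFunctional_monomial,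
        dualFunctional_monomial, sub_eq_zero]
      refine if_congr ⟨?_, ?_⟩ rfl rfl
      · rintro ⟨k, h0, h1, h2⟩
        simp at h0 h1 h2
        match k with
        | 0 => omega
        | k + 1 => exact ⟨k, by simp; linarith, by simp; linarith, by simp; linarith⟩
      · rintro ⟨k, h0, h1, h2⟩
        simp at h0 h1 h2
        exact ⟨k + 1, by simp; linarith, by simp; linarith, by simp; linarith⟩
    · convert mono 0 0 c s r ?_ using 2
      · ring
      · rintro ⟨k, -, -, h⟩
        simp at h
        omega
    · convert mono (a - α) (b - β) 0 s r ?_ using 2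
      · ring
      · rintro ⟨k, h0, h1, -⟩
        simp at h0 h1
        match k with
        | 0 => omega
        | k + 1 => rw [add_mul] at h0; omega
    · convert mono 0 (b - β) (c - γ) s r ?_ using 2
      · ring
      · rintro ⟨k, -, h1, h2⟩
        simp at h1 h2
        match k with
        | 0 => omega
        | k + 1 => rw [add_mul] at h2; omega
  have all : ∀ q, dualFunctional K a b c α β γ (q * p) = 0 := by
    induction hp using Submodule.span_induction with
    | mem g hg =>
      intro q
      induction q using MvPolynomial.induction_on' with
      | monomial s r => exact gen g hg s r
      | add p q hp hq => rw [add_mul, map_add, hp, hq, add_zero]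
    | zero => simp
    | add p q _ _ hp hq => intro r; rw [mul_add, map_add, hp, hq, add_zero]
    | smul q p _ hp => intro r; rw [smul_eq_mul, ← mul_assoc, hp]
  simpa using all 1

/-- The exponents of the standard monomials. -/
def IsStandard (a b c α β γ : ℕ) (s : Fin 3 →₀ ℕ) : Prop :=
  (s 0 < a ∧ s 1 < b - β ∧ s 2 < c) ∨ (s 0 < a - α ∧ b - β ≤ s 1 ∧ s 1 < b ∧ s 2 < c - γ)

theorem exists_standard_sub_mem (hα2 : α ≤ a - 1) (hb : 1 ≤ b) (hγ2 : γ ≤ c - 1)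
    (p : MvPolynomial (Fin 3) K) :
    ∃ q : MvPolynomial (Fin 3) K, (∀ s ∈ q.support, IsStandard a b c α β γ s) ∧
      p - q ∈ binomialIdeal K a b c α β γ := by
  classical
  induction p using MvPolynomial.induction_on' with
  | add p q hp hq =>
    obtain ⟨p', hp', hpI⟩ := hp
    obtain ⟨q', hq', hqI⟩ := hq
    refine ⟨p' + q', fun s hs ↦ ?_, ?_⟩
    · obtain h | h := Finset.mem_union.1 (support_add hs)
      exacts [hp' s h, hq' s h]
    · rw [add_sub_add_comm]
      exact add_mem hpI hqI
  | monomial s r =>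
    obtain ⟨j, hj⟩ : ∃ j, s 1 = j := ⟨_, rfl⟩
    induction j using Nat.strong_induction_on generalizing s with
    | _ j ih =>
    by_cases hst : IsStandard a b c α β γ s
    · refine ⟨monomial s r, fun t ht ↦ ?_, by simp⟩
      rwa [Finset.mem_singleton.1 (support_monomial_subset ht)]
    by_cases hjb : b ≤ j
    · obtain ⟨q, hq, hqI⟩ := ih (j - b) (by omega) (expo (s 0 + α) (j - b) (s 2 + γ)) rfl
      refine ⟨q, hq, ?_⟩
      convert add_mem (Ideal.mul_mem_left _ (C r * (X 0 ^ s 0 * X 1 ^ (j - b) * X 2 ^ s 2))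
        (Ideal.subset_span (show (X 1 ^ b - X 0 ^ α * X 2 ^ γ : MvPolynomial (Fin 3) K) ∈ _ from
          Or.inr (Or.inl rfl)))) hqI using 1
      rw [monomial_fin_three, monomial_expo, hj]
      nth_rw 1 [← Nat.sub_add_cancel hjb]
      ring
    refine ⟨0, by simp, ?_⟩
    rw [sub_zero, monomial_fin_three]
    refine Ideal.mul_mem_left _ _ ?_
    have mem (g q : MvPolynomial (Fin 3) K) (h : g ∣ q)
        (hg : g ∈ ({(X 0 : MvPolynomial (Fin 3) K) ^ a,
          X 1 ^ b - X 0 ^ α * X 2 ^ γ, X 2 ^ c,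
          X 0 ^ (a - α) * X 1 ^ (b - β), X 1 ^ (b - β) * X 2 ^ (c - γ)} : Set _)) :
        q ∈ binomialIdeal K a b c α β γ :=
      Ideal.mem_of_dvd _ h (Ideal.subset_span hg)
    by_cases h0 : a ≤ s 0
    · exact mem _ _ (((pow_dvd_pow _ h0).mul_right _).mul_right _) (by simp)
    by_cases h2 : c ≤ s 2
    · exact mem _ _ ((pow_dvd_pow _ h2).mul_left _) (by simp)
    have h1 : b - β ≤ s 1 := by
      by_contra h
      exact hst (Or.inl (by omega))
    by_cases h0' : a - α ≤ s 0
    · exact mem _ _ ((mul_dvd_mul (pow_dvd_pow _ h0') (pow_dvd_pow _ h1)).mul_right _) (by simp)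
    have h2' : c - γ ≤ s 2 := by
      by_contra h
      exact hst (Or.inr (by omega))
    rw [mul_assoc]
    exact mem _ _ ((mul_dvd_mul (pow_dvd_pow _ h1) (pow_dvd_pow _ h2')).mul_left _) (by simp)

theorem exists_dual_exponent (hα2 : α ≤ a - 1) (hβ2 : β ≤ b - 1) (hγ2 : γ ≤ c - 1)
    {s : Fin 3 →₀ ℕ} (hs : IsStandard a b c α β γ s) :
    ∃ t, IsDualExponent a b c α β γ (s + t) ∧ ∀ s', IsStandard a b c α β γ s' →
      IsDualExponent a b c α β γ (s' + t) → s' = s := by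
  obtain ⟨t, ht⟩ : ∃ t, IsDualExponent a b c α β γ (s + t) := by
    obtain ⟨h0, h1, h2⟩ | ⟨h0, h1, h1', h2⟩ := hs
    · refine ⟨expo (a - 1 - s 0) (b - β - 1 - s 1) (c - 1 - s 2), 0, ?_⟩
      simp
      omega
    · refine ⟨expo (a - α - 1 - s 0) (2 * b - β - 1 - s 1) (c - γ - 1 - s 2), 1, ?_⟩
      simp
      omega
  refine ⟨t, ht, fun s' hs' ⟨k', h0', h1', h2'⟩ ↦ ?_⟩
  obtain ⟨k, h0, h1, h2⟩ := ht
  simp only [Finsupp.add_apply] at h0 h1 h2 h0' h1' h2'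
  have hs1 : s 1 < b := by obtain h | h := hs <;> omega
  have hs1' : s' 1 < b := by obtain h | h := hs' <;> omega
  obtain rfl : k' = k := by
    obtain h | h | h := lt_trichotomy k' k
    · have : (k' + 1 + 1) * b ≤ (k + 1) * b := Nat.mul_le_mul_right _ (by omega)
      rw [add_mul (k' + 1)] at this
      omega
    · exact h
    · have : (k + 1 + 1) * b ≤ (k' + 1) * b := Nat.mul_le_mul_right _ (by omega)
      rw [add_mul (k + 1)] at this
      omega
  exact finsupp_fin_three_ext (by omega) (by omega) (by omega)

open Classical in
theorem dualFunctional_mul_monomial (q : MvPolynomial (Fin 3) K) (t : Fin 3 →₀ ℕ) :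
    dualFunctional K a b c α β γ (q * monomial t 1) =
      ∑ s ∈ q.support, if IsDualExponent a b c α β γ (s + t) then coeff s q else 0 := by
  conv_lhs => rw [q.as_sum, Finset.sum_mul, map_sum]
  simp [monomial_mul, dualFunctional_monomial]

theorem mem_of_dualFunctional_eq_zero (hα1 : 1 ≤ α) (hα2 : α ≤ a - 1) (hβ1 : 1 ≤ β)
    (hβ2 : β ≤ b - 1) (hγ1 : 1 ≤ γ) (hγ2 : γ ≤ c - 1) {p : MvPolynomial (Fin 3) K}
    (hp : ∀ t, dualFunctional K a b c α β γ (p * monomial t 1) = 0) :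
    p ∈ binomialIdeal K a b c α β γ := by
  classical
  obtain ⟨q, hq, hqI⟩ :=
    exists_standard_sub_mem (β := β) hα2 (show 1 ≤ b by omega) hγ2 p
  suffices q = 0 by rwa [this, sub_zero] at hqI
  rw [← support_eq_empty, Finset.eq_empty_iff_forall_notMem]
  intro s hs
  obtain ⟨t, ht, huniq⟩ := exists_dual_exponent hα2 hβ2 hγ2 (hq s hs)
  have h := dualFunctional_eq_zero hα1 hα2 hβ2 hγ1 hγ2 (Ideal.mul_mem_right (monomial t 1) _ hqI)
  rw [sub_mul, map_sub, hp, zero_sub, neg_eq_zero, dualFunctional_mul_monomial,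
    Finset.sum_eq_single_of_mem s hs
      fun s' hs' hne ↦ if_neg fun h ↦ hne (huniq s' (hq s' hs') h), if_pos ht] at h
  exact mem_support_iff.1 hs h

theorem mem_of_forall_mul_mem (hα1 : 1 ≤ α) (hα2 : α ≤ a - 1) (hβ1 : 1 ≤ β)
    (hβ2 : β ≤ b - 1) (hγ1 : 1 ≤ γ) (hγ2 : γ ≤ c - 1) (hαγ : α + γ = b)
    (i : ℕ) (p : MvPolynomial (Fin 3) K) (hp : p.IsHomogeneous i)
    (h : ∀ w : MvPolynomial (Fin 3) K, w.IsHomogeneous (a + b + c - β - 3 - i) →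
      p * w ∈ binomialIdeal K a b c α β γ) :
    p ∈ binomialIdeal K a b c α β γ := by
  refine mem_of_dualFunctional_eq_zero hα1 hα2 hβ1 hβ2 hγ1 hγ2 fun t ↦ ?_
  by_cases ht : t.degree = a + b + c - β - 3 - i
  · exact dualFunctional_eq_zero hα1 hα2 hβ2 hγ1 hγ2 (h _ (isHomogeneous_monomial 1 ht))
  rw [dualFunctional_mul_monomial]
  refine Finset.sum_eq_zero fun s hs ↦ if_neg ?_
  rintro ⟨k, h0, h1, h2⟩
  have hsi : s.degree = i := by
    by_contra h
    exact mem_support_iff.1 hs (hp.coeff_eq_zero h)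
  rw [Finsupp.degree_eq_sum, Fin.sum_univ_three] at hsi ht
  simp only [Finsupp.add_apply] at h0 h1 h2
  have : k * α + k * γ = k * b := by rw [← mul_add, hαγ]
  rw [add_mul] at h1
  omega

attribute [local instance] MvPolynomial.gradedAlgebra in
theorem binomialIdeal_isHomogeneous (hαγ : α + γ = b) :
    (binomialIdeal K a b c α β γ).IsHomogeneous (homogeneousSubmodule (Fin 3) K) := by
  refine Ideal.homogeneous_span _ _ ?_
  rintro g (rfl | rfl | rfl | rfl | rfl)
  · exact ⟨a, isHomogeneous_X_pow _ _⟩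
  · refine ⟨b, (isHomogeneous_X_pow _ _).sub ?_⟩
    rw [← hαγ]
    exact (isHomogeneous_X_pow _ _).mul (isHomogeneous_X_pow _ _)
  · exact ⟨c, isHomogeneous_X_pow _ _⟩
  · exact ⟨_, (isHomogeneous_X_pow _ _).mul (isHomogeneous_X_pow _ _)⟩
  · exact ⟨_, (isHomogeneous_X_pow _ _).mul (isHomogeneous_X_pow _ _)⟩

/-- The weak Lefschetz property reduces to a vanishing statement in the ring `R / (I, L)`. -/
theorem hasWLP_of_vanishing {K : Type u} [Field K] [CharZero K]
    (hα1 : 1 ≤ α) (hα2 : α ≤ a - 1) (hβ1 : 1 ≤ β) (hβ2 : β ≤ b - 1) (hγ1 : 1 ≤ γ) (hγ2 : γ ≤ c - 1) (hαγ : α + γ = b)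
    {L : MvPolynomial (Fin 3) K} (hL : L.IsHomogeneous 1)
    (h : ∀ (Q : Type u) [CommRing Q] (φ : MvPolynomial (Fin 3) K →+* Q),
      (∀ (m : ℤ) (q : Q), m ≠ 0 → m * q = 0 → q = 0) → φ L = 0 →
      φ (X 0) ^ a = 0 → φ (X 1) ^ b = φ (X 0) ^ α * φ (X 2) ^ γ → φ (X 2) ^ c = 0 →
      φ (X 0) ^ (a - α) * φ (X 1) ^ (b - β) = 0 → φ (X 1) ^ (b - β) * φ (X 2) ^ (c - γ) = 0 →
      ∀ i j k, i + j + k = (a + b + c - β - 3) / 2 + 1 →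
        φ (X 0) ^ i * φ (X 1) ^ j * φ (X 2) ^ k = 0) :
    hasWLP K (binomialIdeal K a b c α β γ) := by
  refine hasWLP_of_duality (e := a + b + c - β - 3) (binomialIdeal_isHomogeneous hαγ)
    (fun i _ ↦ mem_of_forall_mul_mem hα1 hα2 hβ1 hβ2 hγ1 hγ2 hαγ i) hL fun i j k hijk ↦ ?_
  set J := binomialIdeal K a b c α β γ ⊔ Ideal.span {L}
  let φ := Ideal.Quotient.mk J
  have hφ {p : MvPolynomial (Fin 3) K} : φ p = 0 ↔ p ∈ J := Ideal.Quotient.eq_zero_iff_mem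
  have gen {g : MvPolynomial (Fin 3) K} (hg : g ∈ ({(X 0 : MvPolynomial (Fin 3) K) ^ a,
      X 1 ^ b - X 0 ^ α * X 2 ^ γ, X 2 ^ c,
      X 0 ^ (a - α) * X 1 ^ (b - β), X 1 ^ (b - β) * X 2 ^ (c - γ)} : Set _)) : φ g = 0 :=
    hφ.2 (Ideal.mem_sup_left (Ideal.subset_span hg))
  have key := h (MvPolynomial (Fin 3) K ⧸ J) φ (fun m q hm hq ↦ ?_)
    (hφ.2 (Ideal.mem_sup_right (Ideal.mem_span_singleton_self L)))
    (by rw [← map_pow]; exact gen (by simp))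
    (by
      rw [← sub_eq_zero, ← map_pow, ← map_pow, ← map_pow, ← map_mul, ← map_sub]
      exact gen (by simp))
    (by rw [← map_pow]; exact gen (by simp))
    (by rw [← map_pow, ← map_pow, ← map_mul]; exact gen (by simp))
    (by rw [← map_pow, ← map_pow, ← map_mul]; exact gen (by simp)) i j k hijk
  · rw [← map_pow, ← map_pow, ← map_pow, ← map_mul, ← map_mul] at key
    exact hφ.1 key
  · have hC : φ (C (m : K)⁻¹) * (m : MvPolynomial (Fin 3) K ⧸ J) = 1 := by
      rw [← map_intCast φ, ← map_mul, ← map_intCast (C : K →+* MvPolynomial (Fin 3) K), ← C_mul,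
        inv_mul_cancel₀ (Int.cast_ne_zero.2 hm), C_1, map_one]
    rw [← one_mul q, ← hC, mul_assoc, hq, mul_zero]

end Parameters

end Core

theorem stmt_2 (K : Type*) [Field K] [CharZero K] (a b c α β γ : ℕ)
    (hα1 : 1 ≤ α) (hα2 : α ≤ a - 1)
    (hβ1 : 1 ≤ β) (hβ2 : β ≤ b - 1)
    (hγ1 : 1 ≤ γ) (hγ2 : γ ≤ c - 1)
    (hαγ : α + γ = b)
    (habc : a = 3 ∨ b = 3 ∨ c = 3) :
    hasWLP K (Ideal.span {(X 0 : MvPolynomial (Fin 3) K) ^ a,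
      X 1 ^ b - X 0 ^ α * X 2 ^ γ, X 2 ^ c,
      X 0 ^ (a - α) * X 1 ^ (b - β), X 1 ^ (b - β) * X 2 ^ (c - γ)}) := by
  change hasWLP K (binomialIdeal K a b c α β γ)
  obtain rfl | hb | rfl := habc
  · refine hasWLP_of_vanishing hα1 hα2 hβ1 hβ2 hγ1 hγ2 hαγ (L := X 1 - (X 0 + X 2))
      ((isHomogeneous_X K 1).sub ((isHomogeneous_X K 0).add (isHomogeneous_X K 2))) ?_
    intro Q _ φ hQ hL h1 h2 h3 h4 h5 i j k h
    rw [map_sub, map_add, sub_eq_zero] at hL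
    exact monomial_eq_zero_of_cube hQ hα1 hα2 hβ1 hβ2 hγ1 hγ2 hαγ h1 hL h2 h3 h4 h5 i j k
      (by omega)
  · obtain rfl | rfl : α = 1 ∨ γ = 1 := by omega
    · obtain rfl : γ = 2 := by omega
      subst hb
      refine hasWLP_of_vanishing hα1 hα2 hβ1 hβ2 hγ1 hγ2 hαγ (L := X 0 - (C 7 * X 1 - C 6 * X 2))
        ((isHomogeneous_X K 0).sub (((isHomogeneous_X K 1).C_mul 7).sub
          ((isHomogeneous_X K 2).C_mul 6))) ?_
      intro Q _ φ hQ hL h1 h2 h3 h4 h5 i j k h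
      rw [map_sub, sub_eq_zero, map_ofNat C, map_ofNat C, map_sub, map_mul, map_mul, map_ofNat φ,
        map_ofNat φ] at hL
      exact monomial_eq_zero_of_binomial_cubic hQ (by omega) (by omega) hβ1 (by omega)
        hL (by simpa using h2) h1 h3 h4 h5 i j k (by omega)
    · obtain rfl : α = 2 := by omega
      subst hb
      refine hasWLP_of_vanishing hα1 hα2 hβ1 hβ2 hγ1 hγ2 hαγ (L := X 2 - (C 7 * X 1 - C 6 * X 0))
        ((isHomogeneous_X K 2).sub (((isHomogeneous_X K 1).C_mul 7).sub
          ((isHomogeneous_X K 0).C_mul 6))) ?_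
      intro Q _ φ hQ hL h1 h2 h3 h4 h5 i j k h
      rw [map_sub, sub_eq_zero, map_ofNat C, map_ofNat C, map_sub, map_mul, map_mul, map_ofNat φ,
        map_ofNat φ] at hL
      have := monomial_eq_zero_of_binomial_cubic hQ (by omega) (by omega) hβ1 (by omega)
        (y := φ (X 1))
        hL (by rw [h2]; ring) h3 h1 (by rw [mul_comm, h5]) (by rw [mul_comm, h4])
        k j i (by omega)
      linear_combination this
  · refine hasWLP_of_vanishing hα1 hα2 hβ1 hβ2 hγ1 hγ2 hαγ (L := X 1 - (X 2 + X 0))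
      ((isHomogeneous_X K 1).sub ((isHomogeneous_X K 2).add (isHomogeneous_X K 0))) ?_
    intro Q _ φ hQ hL h1 h2 h3 h4 h5 i j k h
    rw [map_sub, map_add, sub_eq_zero] at hL
    have := monomial_eq_zero_of_cube hQ hγ1 hγ2 hβ1 hβ2 hα1 hα2 (by omega) h3 hL
      (by rw [h2, mul_comm]) h1 (by rw [mul_comm, h5]) (by rw [mul_comm, h4]) k j i (by omega)
    linear_combination this
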